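/- arXiv:1406.3526 — 3 statements merged into one kernel-verified Lean document; each statement's English description precedes it below -/
import Mathlib

section
/- (Proposition, Properties of ~, item 5: exhaustiveness.) For every x in L: ρ(x) ∪ ~(ρ(x)) = ρ(⊤). -/
def dia {𝒮 : Type*} (R : 𝒮 → 𝒮 → Prop) (S : Set 𝒮) : Set 𝒮 :=
  {s : 𝒮 | ∃ s', R s s' ∧ s' ∈ S}

def box {𝒮 : Type*} (R : 𝒮 → 𝒮 → Prop) (S : Set 𝒮) : Set 𝒮 :=
  {s : 𝒮 | ∀ s', R s s' → s' ∈ S}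

def qneg {𝒮 : Type*} (R : 𝒮 → 𝒮 → Prop) (S : Set 𝒮) : Set 𝒮 := dia R Sᶜ

theorem exhaustiveness_on_image {𝒮 : Type*} (R : 𝒮 → 𝒮 → Prop)
    {L : Type*} [Lattice L] [BoundedOrder L]
    (oc : L → L)
    (hinv : ∀ x, oc (oc x) = x)
    (hdisj : ∀ x, x ⊓ oc x = ⊥)
    (hexh : ∀ x, x ⊔ oc x = ⊤)
    (hanti : ∀ x y : L, x ≤ y → oc y ≤ oc x)
    (hdm : ∀ x y : L, x ⊔ y = oc (oc x ⊓ oc y))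
    (hom : ∀ x y : L, x ≤ y → y = x ⊔ (y ⊓ oc x))
    (ρ : L → Set 𝒮)
    (hinj : Function.Injective ρ)
    (hcomp : ∀ x, ρ (oc x) = qneg R (ρ x))
    (hmeet : ∀ x y, ρ (x ⊓ y) = ρ x ∩ ρ y) :
    ∀ x : L, ρ x ∪ qneg R (ρ x) = ρ (⊤ : L) := by
  have hbot : oc ⊥ = ⊤ := by simpa using hexh ⊥
  have hmono : ∀ y, ρ y ⊆ ρ ⊤ := fun y => by
    have h := hmeet y ⊤
    rw [inf_top_eq] at h
    exact Set.inter_eq_left.mp h.symm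
  intro x
  rw [← hcomp]
  refine (Set.union_subset (hmono x) (hmono (oc x))).antisymm fun s hs => ?_
  rw [← hbot, hcomp] at hs
  obtain ⟨t, hst, ht⟩ := hs
  by_cases htx : t ∈ ρ x
  · left
    rw [← hinv x, hcomp]
    refine ⟨t, hst, fun htc => ht ?_⟩
    rw [← hdisj x, hmeet]
    exact ⟨htx, htc⟩
  · right
    rw [hcomp]
    exact ⟨t, hst, htx⟩
end

section
/- (Proposition, Properties of ~, item 6b: orthomodularity on the image of ρ.) For all x, y in L: if x ≤ y or ρ(x) ⊆ ρ(y), then ρ(y) = ρ(x) ∪ (ρ(y) ∩ ~(ρ(x))). -/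
theorem dia_union {𝒮 : Type*} (R : 𝒮 → 𝒮 → Prop) (S T : Set 𝒮) :
    dia R (S ∪ T) = dia R S ∪ dia R T := by
  ext s
  simp only [dia, Set.mem_union, Set.mem_ofPred_eq, and_or_left, exists_or]

theorem qneg_inter {𝒮 : Type*} (R : 𝒮 → 𝒮 → Prop) (S T : Set 𝒮) :
    qneg R (S ∩ T) = qneg R S ∪ qneg R T := by
  simp only [qneg, Set.compl_inter, dia_union]

theorem orthomodular_on_image {𝒮 : Type*} (R : 𝒮 → 𝒮 → Prop)
    {L : Type*} [Lattice L] [BoundedOrder L]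
    (oc : L → L)
    (hinv : ∀ x, oc (oc x) = x)
    (hdisj : ∀ x, x ⊓ oc x = ⊥)
    (hexh : ∀ x, x ⊔ oc x = ⊤)
    (hanti : ∀ x y : L, x ≤ y → oc y ≤ oc x)
    (hdm : ∀ x y : L, x ⊔ y = oc (oc x ⊓ oc y))
    (hom : ∀ x y : L, x ≤ y → y = x ⊔ (y ⊓ oc x))
    (ρ : L → Set 𝒮)
    (hinj : Function.Injective ρ)
    (hcomp : ∀ x, ρ (oc x) = qneg R (ρ x))
    (hmeet : ∀ x y, ρ (x ⊓ y) = ρ x ∩ ρ y) :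
    ∀ x y : L, (x ≤ y ∨ ρ x ⊆ ρ y) → ρ y = ρ x ∪ (ρ y ∩ qneg R (ρ x)) := by
  have hjoin : ∀ x y, ρ (x ⊔ y) = ρ x ∪ ρ y := fun x y => by
    rw [hdm, hcomp, hmeet, qneg_inter, ← hcomp, ← hcomp, hinv, hinv]
  intro x y h
  have hxy : x ≤ y := h.elim id fun hsub =>
    inf_eq_left.mp (hinj (by rw [hmeet, Set.inter_eq_left.mpr hsub]))
  rw [← hcomp, ← hmeet, ← hjoin, ← hom x y hxy]
end

section
/- (Part of the Representation Theorem: join preservation.) For all x, y in L: ρ(x ⊔ y) = ρ(x) ∪ ρ(y). -/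
theorem join_preservation {𝒮 : Type*} (R : 𝒮 → 𝒮 → Prop)
    {L : Type*} [Lattice L] [BoundedOrder L]
    (oc : L → L)
    (hinv : ∀ x, oc (oc x) = x)
    (hdisj : ∀ x, x ⊓ oc x = ⊥)
    (hexh : ∀ x, x ⊔ oc x = ⊤)
    (hanti : ∀ x y : L, x ≤ y → oc y ≤ oc x)
    (hdm : ∀ x y : L, x ⊔ y = oc (oc x ⊓ oc y))
    (hom : ∀ x y : L, x ≤ y → y = x ⊔ (y ⊓ oc x))
    (ρ : L → Set 𝒮)
    (hinj : Function.Injective ρ)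
    (hcomp : ∀ x, ρ (oc x) = qneg R (ρ x))
    (hmeet : ∀ x y, ρ (x ⊓ y) = ρ x ∩ ρ y) :
    ∀ x y : L, ρ (x ⊔ y) = ρ x ∪ ρ y := by
  intro x y
  rw [hdm, hcomp, hmeet, qneg_inter, ← hcomp, ← hcomp, hinv, hinv]
end
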